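/- Every homogeneous morphism φ: P^N = G(1,N+1) → G(k,n), induced by a group homomorphism GL(N+1) → GL(n) mapping GL(1) into GL(k) and GL(N) into GL(n−k), is k-split: φ^*S_k is isomorphic to a direct sum of line bundles on P^N. -/

import Mathlib

/-- `g` (a matrix in `GL(n)`) is block diagonal for `ℂⁿ = ℂᵏ ⊕ ℂ^{n−k}`, i.e. lies in
the Levi subgroup `GL(k) × GL(n−k)`. -/
def BlockDiag (k : ℕ) {n : ℕ} (g : Matrix (Fin n) (Fin n) ℂ) : Prop :=
  ∀ i j : Fin n, (((i : ℕ) < k ∧ ¬ (j : ℕ) < k) ∨ (¬ (i : ℕ) < k ∧ (j : ℕ) < k)) →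
    g i j = 0

/-- `g` lies in the factor `GL(k)` of `GL(k) × GL(n−k) ⊆ GL(n)`. -/
def InTopFactor (k : ℕ) {n : ℕ} (g : Matrix (Fin n) (Fin n) ℂ) : Prop :=
  BlockDiag k g ∧ ∀ i j : Fin n, ¬ (i : ℕ) < k → ¬ (j : ℕ) < k →
    g i j = if i = j then 1 else 0

/-- `g` lies in the factor `GL(n−k)` of `GL(k) × GL(n−k) ⊆ GL(n)`. -/
def InBotFactor (k : ℕ) {n : ℕ} (g : Matrix (Fin n) (Fin n) ℂ) : Prop :=
  BlockDiag k g ∧ ∀ i j : Fin n, (i : ℕ) < k → (j : ℕ) < k →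
    g i j = if i = j then 1 else 0

open Matrix

theorem map_smul_of_additive_of_polynomial {κ A : Type*} [AddCommGroup A] [Module ℂ A]
    (r : A →+ Matrix κ κ ℂ)
    (hr : ∀ g a b, ∃ P : Polynomial ℂ, ∀ x : ℂ, r (x • g) a b = P.eval x) (x : ℂ) (g : A) :
    r (x • g) = x • r g := by
  ext a b
  obtain ⟨P, hP⟩ := hr g a b
  have hPX : P = Polynomial.X * Polynomial.C (r g a b) := by
    refine Polynomial.eq_of_infinite_eval_eq _ _
      ((Set.infinite_range_of_injective (Nat.cast_injective (R := ℂ))).mono ?_)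
    rintro _ ⟨m, rfl⟩
    rw [Set.mem_ofPred_eq, ← hP, Nat.cast_smul_eq_nsmul, map_nsmul]
    simp [mul_comm (m : ℂ)]
  rw [hP, hPX]
  simp [mul_comm x]

section PolynomialRepresentations

variable {ι κ : Type*} [Fintype ι] [DecidableEq ι] [Fintype κ] [DecidableEq κ]

theorem exists_isUnit_smul_one_sub (g : Matrix ι ι ℂ) :
    ∃ t : ℂ, IsUnit (t • (1 : Matrix ι ι ℂ) - g) := by
  obtain ⟨t, ht⟩ := (Matrix.finite_spectrum (R := ℂ) g).exists_notMem
  exact ⟨t, by simpa [spectrum.notMem_iff, Algebra.algebraMap_eq_smul_one] using ht⟩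

theorem dense_isUnit_smul_one_add (g h : Matrix ι ι ℂ) :
    Dense {t : ℂ | IsUnit (t • (1 : Matrix ι ι ℂ) + g) ∧ IsUnit (t • (1 : Matrix ι ι ℂ) + h)} := by
  have hfin := (Matrix.finite_spectrum (R := ℂ) (-g)).union (Matrix.finite_spectrum (R := ℂ) (-h))
  convert hfin.countable.dense_compl ℂ using 1
  ext t
  simp [spectrum.mem_iff, Algebra.algebraMap_eq_smul_one]

/-- A polynomial representation of `GL` extends to a multiplicative map on all matrices. -/
theorem exists_monoidHom_extension (f : GL ι ℂ →* GL κ ℂ)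
    (q : Matrix κ κ (MvPolynomial (ι × ι) ℂ))
    (hq : ∀ g : GL ι ℂ, (f g : Matrix κ κ ℂ) = fun a b =>
      MvPolynomial.eval (fun ij => (g : Matrix ι ι ℂ) ij.1 ij.2) (q a b)) :
    ∃ Q : Matrix ι ι ℂ →* Matrix κ κ ℂ, (∀ g : GL ι ℂ, Q g = f g) ∧
      ∀ g a b, Q g a b = MvPolynomial.eval (fun ij => g ij.1 ij.2) (q a b) := by
  let F : Matrix ι ι ℂ → Matrix κ κ ℂ := fun g a b =>
    MvPolynomial.eval (fun ij => g ij.1 ij.2) (q a b)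
  have hF (g : GL ι ℂ) : F g = f g := (hq g).symm
  have hcont : Continuous F := by
    refine continuous_matrix fun a b => ?_
    exact (MvPolynomial.continuous_eval (q a b)).comp
      (continuous_pi fun ij => continuous_id.matrix_elem ij.1 ij.2)
  refine ⟨⟨⟨F, by simpa using hF 1⟩, fun g h => ?_⟩, hF, fun _ _ _ => rfl⟩
  have hcg (g : Matrix ι ι ℂ) : Continuous fun t : ℂ => t • (1 : Matrix ι ι ℂ) + g := by fun_prop
  have key := Continuous.ext_on (dense_isUnit_smul_one_add g h)
    (f := fun t : ℂ => F ((t • (1 : Matrix ι ι ℂ) + g) * (t • (1 : Matrix ι ι ℂ) + h)))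
    (g := fun t : ℂ => F (t • (1 : Matrix ι ι ℂ) + g) * F (t • (1 : Matrix ι ι ℂ) + h))
    (hcont.comp ((hcg g).mul (hcg h))) ((hcont.comp (hcg g)).mul (hcont.comp (hcg h)))
    (by
      rintro t ⟨⟨u, hu⟩, ⟨w, hw⟩⟩
      simp only [← hu, ← hw]
      rw [← Units.val_mul, hF, hF, hF, map_mul, Units.val_mul])
  simpa using congrFun key 0

theorem eq_sum_map_mul_single_mul {r : Matrix ι ι ℂ → Matrix κ κ ℂ}
    (hmul : ∀ g h, r (g * h) = r g * r h) (hzero : r 0 = 0) {i₀ : ι}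
    (h₀ : r 1 = r (single i₀ i₀ 1) + r (1 - single i₀ i₀ 1)) (g h : Matrix ι ι ℂ) :
    r (g * h) = ∑ i, r (g * single i i 1 * h) := by
  have hsplit (i : ι) : r 1 = r (single i i 1) + r (1 - single i i 1) := by
    have hW : swap ℂ i₀ i * swap ℂ i₀ i = 1 := swap_mul_self i₀ i
    have hE : swap ℂ i₀ i * single i₀ i₀ 1 * swap ℂ i₀ i = single i i 1 := by
      rw [swap, PEquiv.toMatrix_toPEquiv_mul, PEquiv.mul_toMatrix_toPEquiv, submatrix_submatrix]
      simp
    have := congrArg (fun z => r (swap ℂ i₀ i) * z * r (swap ℂ i₀ i)) h₀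
    simpa only [mul_add, add_mul, ← hmul, mul_one, hW, hE, mul_sub, sub_mul] using this
  have hsum (s : Finset ι) :
      r 1 = ∑ i ∈ s, r (single i i 1) + r (1 - ∑ i ∈ s, single i i 1) := by
    induction s using Finset.induction_on with
    | empty => simp
    | insert a s ha ih =>
      have hEs : (single a a 1 : Matrix ι ι ℂ) * ∑ i ∈ s, single i i 1 = 0 := by
        rw [Finset.mul_sum]
        refine Finset.sum_eq_zero fun i hi => single_mul_single_of_ne _ _ _ _ ?_ _
        rintro rfl
        exact ha hi
      have hstep : r (1 - ∑ i ∈ s, single i i 1) =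
          r (single a a 1) + r (1 - ∑ i ∈ insert a s, single i i 1) := by
        have := congrArg (fun z => z * r (1 - ∑ i ∈ s, single i i 1)) (hsplit a)
        simp only [add_mul, ← hmul, mul_sub, sub_mul, one_mul, mul_one, hEs, sub_zero] at this
        rw [this, Finset.sum_insert ha]
        congr 2
        abel
      rw [Finset.sum_insert ha, ih, hstep]
      abel
  have hone : r 1 = ∑ i, r (single i i 1) := by
    have huniv : ∑ i, (single i i 1 : Matrix ι ι ℂ) = 1 := by
      ext a b
      simp [Matrix.sum_apply, single_apply, one_apply, ite_and]
    have := hsum Finset.univ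
    rwa [huniv, sub_self, hzero, add_zero] at this
  calc r (g * h) = r g * r 1 * r h := by rw [← hmul, ← hmul, mul_one]
    _ = ∑ i, r (g * single i i 1 * h) := by
      rw [hone, Finset.mul_sum, Finset.sum_mul]
      simp only [hmul]

theorem map_add_of_map_mul_eq_sum {r : Matrix ι ι ℂ → Matrix κ κ ℂ}
    (hmul : ∀ g h, r (g * h) = r g * r h) (hzero : r 0 = 0)
    (hsum : ∀ g h, r (g * h) = ∑ i, r (g * single i i 1 * h)) {i₀ i₁ : ι} (hne : i₀ ≠ i₁)
    (g h : Matrix ι ι ℂ) : r (g + h) = r g + r h := by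
  have hadd₀ (x y : ℂ) :
      r (single i₀ i₀ (x + y)) = r (single i₀ i₀ x) + r (single i₀ i₀ y) := by
    have hprod : (single i₀ i₀ x + single i₀ i₁ y) * (single i₀ i₀ 1 + single i₁ i₀ 1) =
        single i₀ i₀ (x + y) := by
      simp [mul_add, add_mul, hne, hne.symm, single_add]
    rw [← hprod, hsum, Finset.sum_eq_add i₀ i₁ hne _ (by simp) (by simp)]
    · simp [mul_add, add_mul, hne, hne.symm]
    · rintro i - ⟨hi₀, hi₁⟩
      simp [add_mul, hi₀.symm, hi₁.symm, hzero]
  have hadd (i j : ι) (x y : ℂ) : r (single i j (x + y)) = r (single i j x) + r (single i j y) := by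
    have hx (z : ℂ) : r (single i j z) =
        r (single i i₀ 1) * r (single i₀ i₀ z) * r (single i₀ j 1) := by
      simp [← hmul]
    rw [hx, hx x, hx y, hadd₀, mul_add, add_mul]
  have hentries (g : Matrix ι ι ℂ) : r g = ∑ i, ∑ j, r (single i j (g i j)) := by
    rw [← one_mul g, hsum]
    refine Finset.sum_congr rfl fun i _ => ?_
    rw [one_mul, ← mul_one (single i i 1 * g), hsum]
    simp [single_mul_mul_single]
  rw [hentries, hentries g, hentries h, ← Finset.sum_add_distrib]
  simp only [← Finset.sum_add_distrib, ← hadd, Matrix.add_apply]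

/-- A polynomial multiplicative map on matrices of size at least two which splits additively
on `diag (x, y, …, y)` at the origin is affine. -/
theorem exists_linearMap_add_of_split (Q : Matrix ι ι ℂ →* Matrix κ κ ℂ)
    (hpoly : ∀ g a b, ∃ P : Polynomial ℂ, ∀ x : ℂ, Q (x • g) a b = P.eval x)
    {i₀ i₁ : ι} (hne : i₀ ≠ i₁)
    (h₀ : Q 0 = Q (single i₀ i₀ 1) + Q (1 - single i₀ i₀ 1) - Q 1) :
    ∃ R : Matrix ι ι ℂ →ₗ[ℂ] Matrix κ κ ℂ, ∀ g, Q g = Q 0 + R g := by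
  let r : Matrix ι ι ℂ → Matrix κ κ ℂ := fun g => Q g - Q 0
  have hmul (g h) : r (g * h) = r g * r h := by
    simp only [r, sub_mul, mul_sub, ← map_mul, mul_zero, zero_mul]
    abel
  have hzero : r 0 = 0 := sub_self _
  have hone : r 1 = r (single i₀ i₀ 1) + r (1 - single i₀ i₀ 1) := by
    simp only [r]
    rw [h₀]
    abel
  have hadd := map_add_of_map_mul_eq_sum hmul hzero (eq_sum_map_mul_single_mul hmul hzero hone) hne
  refine ⟨{ toFun := r
            map_add' := hadd
            map_smul' := map_smul_of_additive_of_polynomial ⟨⟨r, hzero⟩, hadd⟩ ?_ },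
    fun g => (add_sub_cancel _ _).symm⟩
  intro g a b
  obtain ⟨P, hP⟩ := hpoly g a b
  exact ⟨P - Polynomial.C (Q 0 a b), fun x => by simp [r, hP]⟩

/-- A subspace stable under the stabilizer of the line through the `i₀`-th basis vector has a
basis on whose elements the translates are spanned either by constants or by vectors linear in the
`i₀`-th column. -/
theorem exists_adapted_basis (Q : Matrix ι ι ℂ →* Matrix κ κ ℂ)
    (R : Matrix ι ι ℂ →ₗ[ℂ] Matrix κ κ ℂ) (hQR : ∀ g, Q g = Q 0 + R g) (i₀ : ι)
    {k : ℕ} (U : Submodule ℂ (κ → ℂ)) (hk : Module.finrank ℂ U = k)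
    (hU : ∀ (g : Matrix ι ι ℂ) (c : ℂ), IsUnit g → g *ᵥ Pi.single i₀ 1 = c • Pi.single i₀ 1 →
      ∀ u ∈ U, Q g *ᵥ u ∈ U) :
    ∃ (b : Fin k → κ → ℂ) (s : Set (Fin k)),
      ∀ g : GL ι ℂ, U.map (Q g).mulVecLin = Submodule.span ℂ
        (Set.range fun i => open scoped Classical in
          if i ∈ s then b i else R ((g : Matrix ι ι ℂ) * single i₀ i₀ 1) *ᵥ b i) := by
  classical
  set E : Matrix ι ι ℂ := single i₀ i₀ 1 with hE
  have hRQ (g) : R g = Q g - Q 0 := by rw [hQR g, add_sub_cancel_left]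
  have hRR (g h) : R g * R h = R (g * h) := by
    simp only [hRQ, sub_mul, mul_sub, ← map_mul, mul_zero, zero_mul]
    abel
  have hQ₀R (h) : Q 0 * R h = 0 := by simp [hRQ, mul_sub, ← map_mul]
  have hQR' (g h) : Q g * R h = R (g * h) := by rw [hQR, add_mul, hQ₀R, zero_add, hRR]
  have hR₁ (u) (hu : u ∈ U) : R 1 *ᵥ u ∈ U := by
    have h₂ := hU ((2 : ℂ) • 1) 2 ((isUnit_one.smul (Units.mk0 (2 : ℂ) two_ne_zero)))
      (by rw [smul_mulVec, one_mulVec]) u hu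
    have h₁ := hU 1 1 isUnit_one (by rw [one_mulVec, one_smul]) u hu
    convert U.sub_mem h₂ h₁ using 1
    rw [hQR 1, hQR ((2 : ℂ) • 1), map_smul, two_smul, ← sub_mulVec]
    congr 1
    abel
  have hQ₀ (u) (hu : u ∈ U) : Q 0 *ᵥ u ∈ U := by
    have h₁ := hU 1 1 isUnit_one (by rw [one_mulVec, one_smul]) u hu
    convert U.sub_mem h₁ (hR₁ u hu) using 1
    rw [hQR 1, ← sub_mulVec, add_sub_cancel_right]
  have hR (h : Matrix ι ι ℂ) (c : ℂ) (hc : h *ᵥ Pi.single i₀ 1 = c • Pi.single i₀ 1)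
      (u) (hu : u ∈ U) : R h *ᵥ u ∈ U := by
    obtain ⟨t, ht⟩ := exists_isUnit_smul_one_sub h
    have h₁ := hU _ (t - c) ht (by rw [sub_mulVec, hc, smul_mulVec, one_mulVec, sub_smul]) u hu
    convert U.sub_mem (U.add_mem (hQ₀ u hu) (U.smul_mem t (hR₁ u hu))) h₁ using 1
    rw [hQR (t • 1 - h), map_sub, map_smul, ← smul_mulVec, ← add_mulVec, ← sub_mulVec]
    congr 1
    abel
  let K : Submodule ℂ (κ → ℂ) := Submodule.span ℂ
    {x | ∃ u ∈ U, x = Q 0 *ᵥ u ∨ ∃ h : Matrix ι ι ℂ, h *ᵥ Pi.single i₀ 1 = 0 ∧ x = R h *ᵥ u}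
  have hKU : K ≤ U := by
    rw [Submodule.span_le]
    rintro _ ⟨u, hu, rfl | ⟨h, hh, rfl⟩⟩
    · exact hQ₀ u hu
    · exact hR h 0 (by simpa using hh) u hu
  have hKQ (g : Matrix ι ι ℂ) : K ≤ K.comap (Q g).mulVecLin := by
    rw [Submodule.span_le]
    rintro _ ⟨u, hu, rfl | ⟨h, hh, rfl⟩⟩ <;> apply Submodule.subset_span
    · exact ⟨u, hu, Or.inl (by simp [← map_mul])⟩
    · refine ⟨u, hu, Or.inr ⟨g * h, ?_, ?_⟩⟩
      · rw [← mulVec_mulVec, hh, mulVec_zero]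
      · simp [hQR']
  obtain ⟨s, hsK, hs, hsli⟩ := exists_linearIndependent ℂ (K : Set (κ → ℂ))
  rw [Submodule.span_eq] at hs
  obtain ⟨b, hbt, hsb, htb, hbli⟩ := exists_linearIndepOn_id_extension
    (t := K ∪ {x | ∃ u ∈ U, x = R E *ᵥ u}) hsli (hsK.trans Set.subset_union_left)
  have hEe : E *ᵥ Pi.single i₀ 1 = (1 : ℂ) • Pi.single i₀ 1 := by
    ext a
    simp [hE, single_apply, Pi.single_apply, eq_comm]
  have hspan : Submodule.span ℂ b = U := by
    refine le_antisymm (Submodule.span_le.2 fun x hx => ?_) fun u hu => ?_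
    · rcases hbt hx with hx | ⟨u, hu, rfl⟩
      · exact hKU hx
      · exact hR E 1 hEe u hu
    · have hdec : u = (Q 0 *ᵥ u + R (1 - E) *ᵥ u) + R E *ᵥ u := by
        rw [← add_mulVec, ← add_mulVec, add_assoc, ← map_add, sub_add_cancel, ← hQR, map_one,
          one_mulVec]
      rw [hdec]
      refine Submodule.add_mem _ (htb (Or.inl (K.add_mem ?_ ?_))) (htb (Or.inr ⟨u, hu, rfl⟩))
      · exact Submodule.subset_span ⟨u, hu, Or.inl rfl⟩
      · refine Submodule.subset_span ⟨u, hu, Or.inr ⟨1 - E, ?_, rfl⟩⟩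
        rw [sub_mulVec, hEe, one_mulVec, one_smul, sub_self]
  have hbfin : Finite b := hbli.linearIndependent.finite
  have hcard : k = Nat.card b := by
    have := Fintype.ofFinite b
    rw [← hk, ← hspan, finrank_span_set_eq_card hbli.linearIndependent, Set.toFinset_card,
      Nat.card_eq_fintype_card]
  let e : Fin k ≃ b := (finCongr hcard).trans (Finite.equivFin b).symm
  refine ⟨fun i => e i, {i | (e i : κ → ℂ) ∈ K}, fun g => le_antisymm ?_ ?_⟩
  · rw [Submodule.map_le_iff_le_comap]
    refine hspan.ge.trans (Submodule.span_le.2 fun x hx => ?_)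
    rw [SetLike.mem_coe, Submodule.mem_comap, mulVecLin_apply]
    by_cases hxK : x ∈ K
    · have hgx : Q g *ᵥ x ∈ K := hKQ g hxK
      rw [← hs] at hgx
      refine Submodule.span_mono ?_ hgx
      intro y hy
      refine ⟨e.symm ⟨y, hsb hy⟩, ?_⟩
      simp [show y ∈ K from hsK hy]
    · refine Submodule.subset_span ⟨e.symm ⟨x, hx⟩, ?_⟩
      obtain ⟨u, -, rfl⟩ := (hbt hx).resolve_left hxK
      simp only [Equiv.apply_symm_apply, Set.mem_ofPred_eq, hxK, if_false]
      simp [hRR, hQR', mul_assoc, hE]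
  · rw [Submodule.span_le]
    rintro _ ⟨i, rfl⟩
    by_cases hi : (e i : κ → ℂ) ∈ K
    · refine ⟨Q (g⁻¹ : GL ι ℂ) *ᵥ e i, hKU (hKQ _ hi), ?_⟩
      simp [hi, ← map_mul, -coe_units_inv]
    · refine ⟨e i, hspan ▸ Submodule.subset_span (e i).2, ?_⟩
      obtain ⟨u, -, hu⟩ := (hbt (e i).2).resolve_left hi
      simp only [Set.mem_ofPred_eq, hi, if_false]
      simp [hu, hRR, hQR', mul_assoc, hE]

theorem exists_generalLinearGroup_mulVec_eq {x y : ι → ℂ} (hx : x ≠ 0) (hy : y ≠ 0) :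
    ∃ g : GL ι ℂ, (g : Matrix ι ι ℂ) *ᵥ x = y := by
  obtain ⟨A, hA⟩ := SeparatingDual.exists_continuousLinearEquiv_apply_eq (R := ℂ) hx hy
  have hdet : (LinearMap.toMatrix' (A.toLinearEquiv : (ι → ℂ) →ₗ[ℂ] ι → ℂ)).det ≠ 0 := by
    rw [LinearMap.det_toMatrix']
    exact (LinearEquiv.isUnit_det' A.toLinearEquiv).ne_zero
  refine ⟨GeneralLinearGroup.mkOfDetNeZero _ hdet, ?_⟩
  change LinearMap.toMatrix' _ *ᵥ x = y
  rw [LinearMap.toMatrix'_mulVec]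
  exact hA

end PolynomialRepresentations

theorem InTopFactor.mul_eq {k n : ℕ} {A B : Matrix (Fin n) (Fin n) ℂ}
    (hA : InTopFactor k A) (hB : InBotFactor k B) : A * B = A + B - 1 := by
  have hAB : (A - 1) * (B - 1) = 0 := by
    ext i j
    rw [mul_apply]
    refine Finset.sum_eq_zero fun l _ => ?_
    by_cases hl : (l : ℕ) < k
    · refine mul_eq_zero_of_right _ ?_
      by_cases hj : (j : ℕ) < k
      · simp [hB.2 l j hl hj, one_apply]
      · simp [hB.1 l j (Or.inl ⟨hl, hj⟩), one_apply, show l ≠ j by rintro rfl; exact hj hl]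
    · refine mul_eq_zero_of_left ?_ _
      by_cases hi : (i : ℕ) < k
      · simp [hA.1 i l (Or.inl ⟨hi, hl⟩), one_apply, show i ≠ l by rintro rfl; exact hl hi]
      · simp [hA.2 i l hi hl, one_apply]
  rw [← sub_eq_zero, ← hAB]
  noncomm_ring

theorem inTopFactor_one_diagonal {N : ℕ} (t : ℂ) :
    InTopFactor 1 (diagonal fun i : Fin (N + 1) => if i = 0 then t else 1) := by
  refine ⟨fun i j hij => diagonal_apply_ne _ (by rintro rfl; tauto), fun i j hi _ => ?_⟩
  have hi' : i ≠ 0 := by rintro rfl; simp at hi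
  simp [diagonal_apply, hi']

theorem inBotFactor_one_diagonal {N : ℕ} (t : ℂ) :
    InBotFactor 1 (diagonal fun i : Fin (N + 1) => if i = 0 then 1 else t) := by
  refine ⟨fun i j hij => diagonal_apply_ne _ (by rintro rfl; tauto), fun i j hi _ => ?_⟩
  have hi' : i = 0 := Fin.ext (by simpa using hi)
  simp [diagonal_apply, hi']

theorem map_zero_eq_of_factors {N k n : ℕ}
    {Q : Matrix (Fin (N + 1)) (Fin (N + 1)) ℂ →* Matrix (Fin n) (Fin n) ℂ} (hQ : Continuous Q)
    (htop : ∀ g, IsUnit g → InTopFactor 1 g → InTopFactor k (Q g))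
    (hbot : ∀ g, IsUnit g → InBotFactor 1 g → InBotFactor k (Q g)) :
    Q 0 = Q (single 0 0 1) + Q (1 - single 0 0 1) - Q 1 := by
  let D : ℂ → ℂ → Matrix (Fin (N + 1)) (Fin (N + 1)) ℂ := fun x y =>
    diagonal fun i => if i = 0 then x else y
  have hD : Continuous (Function.uncurry D) :=
    Continuous.matrix_diagonal (continuous_pi fun i => by
      by_cases hi : i = 0 <;> simp [hi] <;> fun_prop)
  have hunit {x y : ℂ} (hx : x ≠ 0) (hy : y ≠ 0) : IsUnit (D x y) := by
    simp only [D, isUnit_diagonal, Pi.isUnit_iff]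
    intro i
    split_ifs <;> simpa
  have key := Continuous.ext_on (dense_compl_singleton (0 : ℂ))
    (f := fun t => Q (D t t)) (g := fun t => Q (D t 1) + Q (D 1 t) - 1)
    (hQ.comp (hD.comp (by fun_prop : Continuous fun t : ℂ => (t, t))))
    (((hQ.comp (hD.comp (by fun_prop : Continuous fun t : ℂ => (t, (1 : ℂ))))).add
      (hQ.comp (hD.comp (by fun_prop : Continuous fun t : ℂ => ((1 : ℂ), t))))).sub
      continuous_const)
    (by
      intro t ht
      have hprod : D t t = D t 1 * D 1 t := by
        simp only [D, diagonal_mul_diagonal]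
        congr 1
        ext i
        split_ifs <;> simp
      simp only [hprod, map_mul]
      exact (htop _ (hunit ht one_ne_zero) (inTopFactor_one_diagonal t)).mul_eq
        (hbot _ (hunit one_ne_zero ht) (inBotFactor_one_diagonal t)))
  have h₀ : D 0 0 = 0 := by simp [D]
  have h₁ : D 1 0 = single 0 0 1 := by
    ext i j
    simp only [D, diagonal_apply, single_apply]
    split_ifs <;> grind
  have h₂ : D 0 1 = 1 - single 0 0 1 := by
    ext i j
    simp only [D, diagonal_apply, single_apply, Matrix.sub_apply, one_apply]
    split_ifs <;> grind
  have := congrFun key 0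
  simp only [h₀, h₁, h₂] at this
  rw [this, map_one, add_comm (Q (1 - single 0 0 1))]

/-- Every homogeneous morphism `φ : P^N = G(1,N+1) → G(k,n)`, induced by an (algebraic)
group homomorphism `f̃ : GL(N+1) → GL(n)` mapping `GL(1)` into `GL(k)`, `GL(N)` into
`GL(n−k)`, and the Levi `GL(1) × GL(N)` into `GL(k) × GL(n−k)`, is `k`-split: `φ^* S_k`
is isomorphic to a direct sum of line bundles on `P^N`.  Being `k`-split is expressed in
coordinates: `φ(t) = span{ Σ_j φ_{i,j}(t) v_j : i = 1,…,k }` for homogeneous polynomials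
`φ_{i,j}` of degree `δ i` independent of `j`.  Here `φ` is described on nonzero
homogeneous coordinate vectors `v`, with values the `k`-dimensional subspaces of `ℂⁿ`,
and homogeneity of `φ` means equivariance: `φ(g·v) = f̃(g)·φ(v)`. -/
theorem homogeneous_morphism_is_kSplit (N k n : ℕ)
    (ftil : Matrix.GeneralLinearGroup (Fin (N + 1)) ℂ →* Matrix.GeneralLinearGroup (Fin n) ℂ)
    (hblock : ∀ g : Matrix.GeneralLinearGroup (Fin (N + 1)) ℂ,
      BlockDiag 1 (g : Matrix (Fin (N + 1)) (Fin (N + 1)) ℂ) →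
      BlockDiag k ((ftil g : Matrix (Fin n) (Fin n) ℂ)))
    (htop : ∀ g : Matrix.GeneralLinearGroup (Fin (N + 1)) ℂ,
      InTopFactor 1 (g : Matrix (Fin (N + 1)) (Fin (N + 1)) ℂ) →
      InTopFactor k ((ftil g : Matrix (Fin n) (Fin n) ℂ)))
    (hbot : ∀ g : Matrix.GeneralLinearGroup (Fin (N + 1)) ℂ,
      InBotFactor 1 (g : Matrix (Fin (N + 1)) (Fin (N + 1)) ℂ) →
      InBotFactor k ((ftil g : Matrix (Fin n) (Fin n) ℂ)))
    (halg : ∃ q : Matrix (Fin n) (Fin n) (MvPolynomial (Fin (N + 1) × Fin (N + 1)) ℂ),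
      ∀ g : Matrix.GeneralLinearGroup (Fin (N + 1)) ℂ,
        (ftil g : Matrix (Fin n) (Fin n) ℂ) = fun a b =>
          MvPolynomial.eval (fun ij => (g : Matrix (Fin (N + 1)) (Fin (N + 1)) ℂ) ij.1 ij.2)
            (q a b))
    (φ : (Fin (N + 1) → ℂ) → Submodule ℂ (Fin n → ℂ))
    (hscale : ∀ (c : ℂ) (v : Fin (N + 1) → ℂ), c ≠ 0 → φ (c • v) = φ v)
    (hdim : ∀ v : Fin (N + 1) → ℂ, v ≠ 0 → Module.finrank ℂ (φ v) = k)
    (hequiv : ∀ (g : Matrix.GeneralLinearGroup (Fin (N + 1)) ℂ) (v : Fin (N + 1) → ℂ),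
      φ ((g : Matrix (Fin (N + 1)) (Fin (N + 1)) ℂ).mulVec v) =
        Submodule.map ((ftil g : Matrix (Fin n) (Fin n) ℂ).mulVecLin) (φ v)) :
    ∃ (δ : Fin k → ℕ) (p : Fin k → Fin n → MvPolynomial (Fin (N + 1)) ℂ),
      (∀ i j, (p i j).IsHomogeneous (δ i)) ∧
      ∀ v : Fin (N + 1) → ℂ, v ≠ 0 →
        φ v = Submodule.span ℂ
          (Set.range fun i : Fin k => fun j => MvPolynomial.eval v (p i j)) := by
  obtain ⟨q, hq⟩ := halg
  have he : (Pi.single 0 1 : Fin (N + 1) → ℂ) ≠ 0 := by simp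
  rcases Nat.eq_zero_or_pos N with rfl | hN
  · have hfin (i : Fin (0 + 1)) : i = 0 := Fin.ext (by omega)
    let b := Module.finBasisOfFinrankEq ℂ (φ (Pi.single 0 1)) (hdim _ he)
    refine ⟨fun _ => 0, fun i j => MvPolynomial.C ((b i : Fin n → ℂ) j),
      fun i j => MvPolynomial.isHomogeneous_C _ _, fun v hv => ?_⟩
    have hv₀ : v 0 ≠ 0 := fun h => hv (by ext i; rw [hfin i, h]; rfl)
    have hvφ : φ v = φ (Pi.single 0 1) := by
      rw [← hscale (v 0) (Pi.single 0 1) hv₀]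
      congr 1
      ext i
      simp [hfin i]
    have hspan := congrArg (Submodule.map (φ (Pi.single 0 1)).subtype) b.span_eq
    rw [Submodule.map_span, ← Set.range_comp, Submodule.map_top, Submodule.range_subtype] at hspan
    rw [hvφ]
    refine hspan.symm.trans ?_
    congr 2
    ext i j
    simp
  · obtain ⟨Q, hQf, hQq⟩ := exists_monoidHom_extension ftil q hq
    have hQcont : Continuous Q := by
      refine continuous_matrix fun a b => ?_
      simp only [hQq]
      exact (MvPolynomial.continuous_eval (q a b)).comp
        (continuous_pi fun ij => continuous_id.matrix_elem ij.1 ij.2)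
    have hQpoly (g) (a b) : ∃ P : Polynomial ℂ, ∀ x : ℂ, Q (x • g) a b = P.eval x := by
      refine ⟨MvPolynomial.aeval
        (fun ij => Polynomial.X * Polynomial.C (g ij.1 ij.2)) (q a b), fun x => ?_⟩
      have hcomp : (Polynomial.aeval x).comp (MvPolynomial.aeval
          fun ij : Fin (N + 1) × Fin (N + 1) => Polynomial.X * Polynomial.C (g ij.1 ij.2)) =
          MvPolynomial.aeval fun ij => (x • g) ij.1 ij.2 := by
        ext
        simp [mul_comm x]
      rw [hQq, ← MvPolynomial.coe_aeval_eq_eval, ← Polynomial.coe_aeval_eq_eval]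
      exact (DFunLike.congr_fun hcomp (q a b)).symm
    have h₀ := map_zero_eq_of_factors (k := k) hQcont
      (by rintro _ ⟨g, rfl⟩ hg; rw [hQf]; exact htop g hg)
      (by rintro _ ⟨g, rfl⟩ hg; rw [hQf]; exact hbot g hg)
    obtain ⟨R, hR⟩ := exists_linearMap_add_of_split Q hQpoly
      (i₁ := (⟨1, by omega⟩ : Fin (N + 1))) (by simp [Fin.ext_iff]) h₀
    obtain ⟨b, s, hb⟩ := exists_adapted_basis Q R hR 0 (φ (Pi.single 0 1)) (hdim _ he) (by
      rintro _ c ⟨g, rfl⟩ hg u hu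
      have hc : c ≠ 0 := by
        rintro rfl
        refine he (mulVec_injective_of_isUnit g.isUnit ?_)
        rw [hg, zero_smul, mulVec_zero]
      rw [← hscale c _ hc, ← hg, hequiv, ← hQf]
      exact ⟨u, hu, rfl⟩)
    classical
    refine ⟨fun i => if i ∈ s then 0 else 1, fun i a => if i ∈ s then MvPolynomial.C (b i a) else
      ∑ j, MvPolynomial.C ((R (single j 0 1) *ᵥ b i) a) * MvPolynomial.X j, fun i a => ?_,
      fun v hv => ?_⟩
    · dsimp only
      split_ifs
      · exact MvPolynomial.isHomogeneous_C _ _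
      · exact MvPolynomial.IsHomogeneous.sum _ _ _ fun j _ =>
          MvPolynomial.isHomogeneous_C_mul_X _ _
    · obtain ⟨g, hg⟩ := exists_generalLinearGroup_mulVec_eq he hv
      have hgE : (g : Matrix (Fin (N + 1)) (Fin (N + 1)) ℂ) * single 0 0 1 =
          ∑ j, v j • single j 0 1 := by
        ext i j
        have hi : (g : Matrix (Fin (N + 1)) (Fin (N + 1)) ℂ) i 0 = v i := by simp [← hg]
        rcases eq_or_ne j 0 with rfl | hj
        · simp [Matrix.sum_apply, single_apply, hi]
        · simp [Matrix.sum_apply, hj, hj.symm]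
      rw [show φ v = _ from hg ▸ hequiv g (Pi.single 0 1), ← hQf, hb]
      congr 2
      funext i a
      split_ifs with hi
      · simp [hi]
      · rw [hgE, map_sum, sum_mulVec]
        simp only [hi, if_false, map_smul, smul_mulVec]
        simp [mul_comm (v _), -smul_single]
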